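/- If T is a tree of order n ≥ 2, then the total restrained domination number satisfies γ_t^r(T) ≥ ⌈(n + 2)/2⌉. -/

import Mathlib

open Finset

/-- A set `S` of vertices is a `(k,k',k'')`-dominating set if every vertex in `S` has at
least `k` neighbors in `S`, and every vertex not in `S` has at least `k'` neighbors in `S`
and at least `k''` neighbors outside `S`. -/
def SimpleGraph.IsKkkDomSet {V : Type*} [Fintype V] [DecidableEq V] (G : SimpleGraph V)
    [DecidableRel G.Adj] (k k' k'' : ℕ) (S : Finset V) : Prop :=
  (∀ v ∈ S, k ≤ (G.neighborFinset v ∩ S).card) ∧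
  (∀ v ∉ S, k' ≤ (G.neighborFinset v ∩ S).card ∧ k'' ≤ (G.neighborFinset v \ S).card)

/-- The `(k,k',k'')`-domination number: the minimum cardinality of a
`(k,k',k'')`-dominating set. -/
noncomputable def SimpleGraph.kkkDomNum {V : Type*} [Fintype V] [DecidableEq V]
    (G : SimpleGraph V) [DecidableRel G.Adj] (k k' k'' : ℕ) : ℕ :=
  sInf {n | ∃ S : Finset V, G.IsKkkDomSet k k' k'' S ∧ S.card = n}

namespace SimpleGraph

variable {V : Type*} [Fintype V] [DecidableEq V] (G : SimpleGraph V) [DecidableRel G.Adj]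

/-- Counting the edges between `A` and `B` from either side gives the same number. -/
theorem sum_card_neighborFinset_inter_comm (A B : Finset V) :
    ∑ v ∈ A, (G.neighborFinset v ∩ B).card = ∑ v ∈ B, (G.neighborFinset v ∩ A).card := by
  have h := Finset.sum_card_bipartiteAbove_eq_sum_card_bipartiteBelow (s := A) (t := B) G.Adj
  convert h using 3 with v hv v hv
  · ext w
    simp [Finset.bipartiteAbove, and_comm]
  · ext w
    simp [Finset.bipartiteBelow, and_comm, G.adj_comm v w]

theorem univ_isKkkDomSet (hdeg : ∀ v, 1 ≤ G.degree v) (k' k'' : ℕ) :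
    G.IsKkkDomSet 1 k' k'' Finset.univ :=
  ⟨fun v _ => by simpa using hdeg v, fun v hv => absurd (Finset.mem_univ v) hv⟩

variable {G}

/-- A total restrained dominating set `S` forces
`|S| + 3 |Sᶜ| ≤ 2 |E|`. -/
theorem IsKkkDomSet.card_add_three_mul_card_compl_le {S : Finset V}
    (hS : G.IsKkkDomSet 1 1 1 S) : S.card + 3 * Sᶜ.card ≤ 2 * G.edgeFinset.card := by
  have hinner : S.card ≤ ∑ v ∈ S, (G.neighborFinset v ∩ S).card := by
    simpa using Finset.card_nsmul_le_sum S _ 1 hS.1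
  have hcross : Sᶜ.card ≤ ∑ v ∈ Sᶜ, (G.neighborFinset v ∩ S).card := by
    simpa using Finset.card_nsmul_le_sum Sᶜ _ 1
      fun v hv => (hS.2 v (Finset.mem_compl.1 hv)).1
  have houter : Sᶜ.card ≤ ∑ v ∈ Sᶜ, (G.neighborFinset v \ S).card := by
    simpa using Finset.card_nsmul_le_sum Sᶜ _ 1
      fun v hv => (hS.2 v (Finset.mem_compl.1 hv)).2
  have hcomm : ∑ v ∈ S, (G.neighborFinset v \ S).card =
      ∑ v ∈ Sᶜ, (G.neighborFinset v ∩ S).card := by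
    simpa only [Finset.sdiff_eq_inter_compl] using G.sum_card_neighborFinset_inter_comm S Sᶜ
  have hsplit (A : Finset V) : ∑ v ∈ A, G.degree v =
      ∑ v ∈ A, (G.neighborFinset v ∩ S).card + ∑ v ∈ A, (G.neighborFinset v \ S).card := by
    rw [← Finset.sum_add_distrib]
    exact Finset.sum_congr rfl fun v _ => by
      rw [Finset.card_inter_add_card_sdiff, G.card_neighborFinset_eq_degree]
  rw [← G.sum_degrees_eq_twice_card_edges, ← Finset.sum_add_sum_compl S, hsplit, hsplit]
  omega

end SimpleGraph

/-- If T is a tree of order n ≥ 2, then γ_t^r(T) = γ_{(1,1,1)}(T) ≥ ⌈(n+2)/2⌉. -/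
theorem stmt_15 {V : Type*} [Fintype V] [DecidableEq V] (T : SimpleGraph V)
    [DecidableRel T.Adj] (htree : T.IsTree) (hn : 2 ≤ Fintype.card V) :
    (⌈((Fintype.card V : ℚ) + 2) / 2⌉ : ℤ) ≤ (T.kkkDomNum 1 1 1 : ℤ) := by
  have : Nontrivial V := Fintype.one_lt_card_iff_nontrivial.1 hn
  have hne : {n | ∃ S : Finset V, T.IsKkkDomSet 1 1 1 S ∧ S.card = n}.Nonempty :=
    ⟨_, _, T.univ_isKkkDomSet
      (fun v => htree.connected.preconnected.degree_pos_of_nontrivial v) 1 1, rfl⟩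
  obtain ⟨S, hS, hcard⟩ := Nat.sInf_mem hne
  change S.card = T.kkkDomNum 1 1 1 at hcard
  have hle := hS.card_add_three_mul_card_compl_le
  have hedge := htree.card_edgeFinset
  have hcompl := S.card_add_card_compl
  have hbound : Fintype.card V + 2 ≤ 2 * T.kkkDomNum 1 1 1 := by omega
  have hcast : (Fintype.card V : ℚ) + 2 ≤ 2 * (T.kkkDomNum 1 1 1 : ℚ) := by exact_mod_cast hbound
  rw [Int.ceil_le]
  push_cast
  linarith
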